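/- Let k, s, m, n be positive integers with k < m ≤ n and gcd(s,n) = 1, and let U be an m-dimensional K-subspace of F with 1 ∈ U. Let t be the smallest positive integer such that U is contained in the intermediate field E of F/K with [E:K] = t, and write r = n/t. Then the right nucleus of π_U(G_{k,s}) is N_r(π_U(G_{k,s})) = {Σ_{i=0}^{r−1} c_i X^{q^{it}} : c_0, ..., c_{r−1} ∈ F}. -/

import Mathlib

theorem aux_by_parts {F : Type*} [Field F] (b y : ℕ → F) (d : ℕ) :
    ∑ i ∈ Finset.range (d + 1), b i * y i =
      ∑ i ∈ Finset.range d, (-(∑ l ∈ Finset.range (i + 1), b l)) * (y (i + 1) - y i)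
        + (∑ l ∈ Finset.range (d + 1), b l) * y d := by
  induction d with
  | zero => simp
  | succ d ih =>
    rw [Finset.sum_range_succ, ih,
      Finset.sum_range_succ
        (fun i => (-(∑ l ∈ Finset.range (i + 1), b l)) * (y (i + 1) - y i)) d,
      Finset.sum_range_succ b (d + 1)]
    ring

theorem aux_key {K F : Type*} [Field K] [Field F] [Algebra K F] [FiniteDimensional K F]
    (σ : F →ₐ[K] F) (hσ : ∀ x, σ x = x → ∃ c : K, algebraMap K F c = x) :
    ∀ (d : ℕ) (U : Submodule K F), d < Module.finrank K U → ∀ b : ℕ → F,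
      (∀ x ∈ U, ∑ i ∈ Finset.range (d + 1), b i * (σ ^ i) x = 0) → ∀ i ≤ d, b i = 0 := by
  intro d
  induction d with
  | zero =>
    intro U hU b hb i hi
    obtain ⟨u, hu⟩ := (Module.finrank_pos_iff_exists_ne_zero (R := K) (M := U)).1 hU
    have := hb u u.2
    have hu' : (u : F) ≠ 0 := by simpa using hu
    obtain rfl : i = 0 := by omega
    simpa [hu'] using this
  | succ d ih =>
    intro U hU b hb
    obtain ⟨u, hu⟩ := (Module.finrank_pos_iff_exists_ne_zero (R := K) (M := U)).1 (by omega)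
    have hu' : (u : F) ≠ 0 := by simpa using hu
    let D : U →ₗ[K] F :=
      (σ.toLinearMap - LinearMap.id) ∘ₗ (LinearMap.mulRight K (u : F)⁻¹) ∘ₗ U.subtype
    have hD : ∀ x : U, D x = σ (x * (u : F)⁻¹) - x * (u : F)⁻¹ := fun x => rfl
    have hker : Module.finrank K (LinearMap.ker D) ≤ 1 := by
      refine finrank_le_one ⟨u, ?_⟩ ?_
      · rw [LinearMap.mem_ker, hD, mul_inv_cancel₀ hu']; simp
      · rintro ⟨w, hw⟩
        rw [LinearMap.mem_ker, hD, sub_eq_zero] at hw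
        obtain ⟨c, hc⟩ := hσ _ hw
        refine ⟨c, ?_⟩
        apply Subtype.ext
        apply Subtype.ext
        simp only [Submodule.coe_smul, Algebra.smul_def, hc]
        field_simp
    have hrk := LinearMap.finrank_range_add_finrank_ker D
    set b' : ℕ → F := fun i => b i * (σ ^ i) u with hb'
    have hcomp : ∀ x ∈ U, ∀ i, b i * (σ ^ i) x = b' i * (σ ^ i) (x * (u : F)⁻¹) := by
      intro x hx i
      have : (σ ^ i) x = (σ ^ i) u * (σ ^ i) (x * (u : F)⁻¹) := by
        rw [← map_mul]; congr 1; field_simp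
      rw [this, hb']; ring
    have hsum : ∑ l ∈ Finset.range (d + 1 + 1), b' l = 0 := by
      rw [← hb u u.2]
    have h1 := ih (LinearMap.range D) (by omega)
      (fun i => -(∑ l ∈ Finset.range (i + 1), b' l)) (by
        rintro _ ⟨x, rfl⟩
        have h2 := hb x x.2
        simp_rw [hcomp x x.2] at h2
        rw [aux_by_parts b' (fun i => (σ ^ i) ((x : F) * (u : F)⁻¹)) (d + 1), hsum] at h2
        rw [← h2, zero_mul, add_zero]
        refine Finset.sum_congr rfl fun i _ => ?_
        rw [hD, map_sub, pow_succ]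
        rfl)
    have h2 : ∀ i ≤ d + 2, ∑ l ∈ Finset.range i, b' l = 0 := by
      intro i hi
      rcases i with _ | i
      · simp
      · rcases (show i ≤ d ∨ i = d + 1 by omega) with h | h
        · exact neg_eq_zero.1 (h1 i h)
        · rw [h]; exact hsum
    intro i hi
    have h3 := h2 (i + 1) (by omega)
    rw [Finset.sum_range_succ, h2 i (by omega), zero_add] at h3
    have h4 : (σ ^ i) (u : F) ≠ 0 := (map_ne_zero (σ ^ i)).2 hu'
    exact (mul_eq_zero.1 h3).resolve_right h4

theorem aux_fix {K F : Type*} [Field K] [Field F] [Algebra K F] [FiniteDimensional K F]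
    (σ g : F →ₐ[K] F) (hσ : ∀ x, σ x = x → ∃ c : K, algebraMap K F c = x)
    (hg : ∀ i x, g ((σ ^ i) x) = (σ ^ i) (g x))
    (U : Submodule K F) (hone : (1 : F) ∈ U) (k : ℕ) (hk : 0 < k) (hkU : k < Module.finrank K U)
    (H : ∀ i < k, ∃ a : ℕ → F, ∀ x ∈ U,
      g ((σ ^ i) x) = ∑ l ∈ Finset.range k, a l * (σ ^ l) x) :
    ∀ x ∈ U, g x = x := by
  obtain ⟨a, ha⟩ := H 0 hk
  simp only [pow_zero, AlgHom.one_apply] at ha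
  have hz : ∀ e d, d + e + 1 = k → 0 < d → a d = 0 := by
    intro e
    induction e using Nat.strong_induction_on with
    | _ e ih =>
    intro d hd hd0
    have hgt : ∀ l ∈ Finset.range k, l ∉ Finset.range (d + 1) → a l * 1 = 0 := by
      intro l hl hl'
      simp only [Finset.mem_range] at hl hl'
      rw [mul_one]
      exact ih (k - 1 - l) (by omega) l (by omega) (by omega)
    obtain ⟨a', ha'⟩ := H (e + 1) (by omega)
    have hx : ∀ x ∈ U, ∑ j ∈ Finset.range (k + 1),
        ((if e + 1 ≤ j then (σ ^ (e + 1)) (a (j - (e + 1))) else 0)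
          - (if j < k then a' j else 0)) * (σ ^ j) x = 0 := by
      intro x hx
      have h1 := ha' x hx
      rw [hg, ha x hx, map_sum] at h1
      have h2 : ∑ j ∈ Finset.range (k + 1), (if j < k then a' j else 0) * (σ ^ j) x
          = ∑ l ∈ Finset.range k, a' l * (σ ^ l) x := by
        rw [Finset.sum_range_succ]
        simp only [lt_irrefl, if_false, zero_mul, add_zero]
        exact Finset.sum_congr rfl fun j hj => by rw [if_pos (Finset.mem_range.1 hj)]
      have h3 : ∑ j ∈ Finset.range (k + 1),
          (if e + 1 ≤ j then (σ ^ (e + 1)) (a (j - (e + 1))) else 0) * (σ ^ j) x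
          = ∑ l ∈ Finset.range k, (σ ^ (e + 1)) (a l * (σ ^ l) x) := by
        rw [show k + 1 = (e + 1) + (d + 1) by omega, Finset.sum_range_add,
          Finset.sum_eq_zero (s := Finset.range (e + 1)), zero_add]
        · have hsub : Finset.range (d + 1) ⊆ Finset.range k := by
            intro l; simp only [Finset.mem_range]; omega
          rw [← Finset.sum_subset hsub]
          · refine Finset.sum_congr rfl fun l _ => ?_
            rw [if_pos (by omega), Nat.add_sub_cancel_left, map_mul, pow_add σ (e + 1) l]
            rfl
          · intro l hl hl'
            have := hgt l hl hl'
            rw [mul_one] at this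
            rw [this, zero_mul, map_zero]
        · intro l hl
          rw [if_neg (by simp only [Finset.mem_range] at hl; omega), zero_mul]
      simp_rw [sub_mul]
      rw [Finset.sum_sub_distrib, h2, h3, h1, sub_self]
    have h4 := aux_key σ hσ k U hkU _ hx k le_rfl
    simp only [lt_irrefl, if_false, sub_zero] at h4
    rw [if_pos (by omega), show k - (e + 1) = d by omega] at h4
    exact (map_eq_zero _).1 h4
  have h0 : ∀ x ∈ U, g x = a 0 * x := by
    intro x hx
    rw [ha x hx, Finset.sum_eq_single 0]
    · simp
    · intro l hl hl0
      rw [Finset.mem_range] at hl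
      rw [hz (k - 1 - l) l (by omega) (by omega), zero_mul]
    · intro h; simp at h; omega
  have h1 := h0 1 hone
  rw [map_one, mul_one] at h1
  intro x hx
  rw [h0 x hx, ← h1, one_mul]

theorem aux_dedekind {K F W ι : Type*} [Field K] [Field F] [Algebra K F] [AddCommGroup W]
    [Module F W] [Fintype ι] (V : Submodule F W) (h : ι → F →ₐ[K] F)
    (hinj : Function.Injective h) (w : ι → W) (H : ∀ a, ∑ j, h j a • w j ∈ V) (j : ι) :
    w j ∈ V := by
  rw [← Submodule.Quotient.mk_eq_zero V, ← Module.forall_dual_apply_eq_zero_iff F]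
  intro l
  have hli := (linearIndependent_toLinearMap K F F).comp h hinj
  rw [Fintype.linearIndependent_iff] at hli
  refine hli (fun j => l (Submodule.Quotient.mk (w j))) ?_ j
  ext a
  have h1 := (Submodule.Quotient.mk_eq_zero V).2 (H a)
  have h2 := congrArg (fun z => l z) h1
  simp only [← Submodule.mkQ_apply, map_sum, map_smul, map_zero] at h2
  simp only [LinearMap.sum_apply, LinearMap.smul_apply, Function.comp_apply, smul_eq_mul,
    AlgHom.toLinearMap_apply, LinearMap.zero_apply]
  rw [← h2]
  refine Finset.sum_congr rfl fun j _ => ?_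
  rw [smul_eq_mul, mul_comm]; rfl

theorem aux_frob_pow (K F : Type*) [Field K] [Fintype K] [Field F] [Algebra K F]
    (j : ℕ) (x : F) :
    (FiniteField.frobeniusAlgHom K F ^ j) x = x ^ Fintype.card K ^ j := by
  rw [AlgHom.coe_pow, FiniteField.coe_frobeniusAlgHom, pow_iterate]



/-- The set `G_{k,s}` of linearized polynomials
`a₀ X + a₁ X^{q^s} + ⋯ + a_{k-1} X^{q^{s(k-1)}}` with `a₀, …, a_{k-1} ∈ F`. -/
def Gks (q k s : ℕ) (F : Type*) [Field F] : Set (Polynomial F) :=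
  {p | ∃ a : Fin k → F, p = ∑ i : Fin k, Polynomial.C (a i) * Polynomial.X ^ q ^ (s * (i : ℕ))}

/-- The right nucleus `N_r(π_U(C)) = {φ ∈ End_K(F) : π_U(φ ∘ f) ∈ π_U(C) ∀ f ∈ C}`
of the projection to `U` of a set `C` of (linearized) polynomials. -/
def rightNucleus {K F : Type*} [Field K] [Field F] [Algebra K F]
    (U : Submodule K F) (C : Set (Polynomial F)) : Set (Module.End K F) :=
  {φ | ∀ f ∈ C, ∃ g ∈ C, ∀ x ∈ U, φ (f.eval x) = g.eval x}

/-- Let `U` be an `m`-dimensional `K`-subspace of `F` with `1 ∈ U` and let `t` be the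
smallest positive integer such that `U` is contained in the intermediate field `E` of
`F/K` with `[E:K] = t`; write `r = n/t`. Then the right nucleus of the projected
Gabidulin code `π_U(G_{k,s})` is `{Σ_{i=0}^{r-1} c_i X^{q^{it}} : c_0, …, c_{r-1} ∈ F}`. -/
theorem right_nucleus_of_gabidulin
    (K F : Type*) [Field K] [Fintype K] [Field F] [Fintype F] [Algebra K F]
    (q k s m n t r : ℕ) (hq : q = Fintype.card K) (hn : Module.finrank K F = n)
    (hs : 0 < s) (hgcd : Nat.gcd s n = 1) (hk : 0 < k) (hkm : k < m) (hmn : m ≤ n)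
    (U : Submodule K F) (hU : Module.finrank K U = m) (hone : (1 : F) ∈ U)
    (E : IntermediateField K F) (hEt : Module.finrank K E = t)
    (hUE : (U : Set F) ⊆ (E : Set F))
    (htmin : ∀ E' : IntermediateField K F, (U : Set F) ⊆ (E' : Set F) →
      t ≤ Module.finrank K E')
    (hr : r = n / t) :
    rightNucleus U (Gks q k s F) =
      {φ : Module.End K F | ∃ c : Fin r → F,
        ∀ x : F, φ x = ∑ i : Fin r, c i * x ^ q ^ (t * (i : ℕ))} := by
  subst hq
  haveI : FiniteDimensional K F := inferInstance
  have htpos : 0 < t := hEt ▸ Module.finrank_pos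
  have hnr : n = t * r := by
    have h1 : t ∣ n := by
      rw [← hEt, ← hn]; exact ⟨_, (Module.finrank_mul_finrank K E F).symm⟩
    rw [hr, Nat.mul_div_cancel' h1]
  set fr := FiniteField.frobeniusAlgHom K F with hfr
  have hfrp : ∀ j x, (fr ^ j) x = x ^ Fintype.card K ^ j := aux_frob_pow K F
  have hEfix : ∀ x ∈ E, ∀ i, x ^ Fintype.card K ^ (t * i) = x := by
    intro x hx i
    have h1 : (FiniteField.frobeniusAlgHom K E) ^ (t * i) = 1 := by
      rw [pow_mul, ← hEt, ← FiniteField.orderOf_frobeniusAlgHom K E, pow_orderOf_eq_one, one_pow]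
    have h2 := congrArg (fun f => ((f (⟨x, hx⟩ : E) : E) : F)) h1
    simp only [aux_frob_pow] at h2
    simpa using h2
  ext φ
  simp only [rightNucleus, Set.mem_setOf_eq]
  constructor
  · intro hφ
    have hinj : Function.Injective (fun j : Fin n => fr ^ (j : ℕ)) := by
      subst hn; exact (FiniteField.bijective_frobeniusAlgHom_pow K F).1
    have hli := (linearIndependent_toLinearMap K F F).comp _ hinj
    have hspan := hli.span_eq_top_of_card_eq_finrank' (by
      rw [Module.finrank_linearMap_self, hn, Fintype.card_fin])
    obtain ⟨c, hc⟩ := (Submodule.mem_span_range_iff_exists_fun F).1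
      (hspan.symm ▸ (Submodule.mem_top : φ ∈ (⊤ : Submodule F (F →ₗ[K] F))))
    have hc' : ∀ x, φ x = ∑ j : Fin n, c j * (fr ^ (j : ℕ)) x := by
      intro x
      rw [← hc]
      simp [LinearMap.sum_apply]
    set σ := fr ^ s with hσd
    have hσp : ∀ i x, (σ ^ i) x = x ^ Fintype.card K ^ (s * i) := by
      intro i x; rw [hσd, ← pow_mul, hfrp]
    have hσ : ∀ x, σ x = x → ∃ c : K, algebraMap K F c = x := by
      intro x hx
      obtain ⟨m', hm'⟩ := exists_pow_eq_self_of_coprime (x := fr) (n := s) (by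
        rw [hfr, FiniteField.orderOf_frobeniusAlgHom, hn]; exact hgcd)
      have h1 : ∀ j, (σ ^ j) x = x := by
        intro j
        induction j with
        | zero => rfl
        | succ j ih => rw [pow_succ, AlgHom.mul_apply, hx, ih]
      have h2 : ∀ f : F ≃ₐ[K] F, f x = x := by
        intro f
        obtain ⟨j, hj⟩ := (FiniteField.bijective_frobeniusAlgHom_pow K F).2 (f : F →ₐ[K] F)
        have h3 : f x = (fr ^ (j : ℕ)) x := (DFunLike.congr_fun hj x).symm
        rw [h3, ← hm', ← pow_mul, h1]
      have h4 := (IsGalois.mem_bot_iff_fixed (F := K) x).2 h2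
      exact IntermediateField.mem_bot.1 h4
    let V : Submodule F (U → F) :=
      Submodule.span F (Set.range fun i : Fin k => fun x : U => (σ ^ (i : ℕ)) (x : F))
    have hV : ∀ i < k, ∀ j : Fin n,
        (c j • fun x : U => (fr ^ (j : ℕ)) ((σ ^ i) (x : F))) ∈ V := by
      intro i hi j
      refine aux_dedekind V (fun j : Fin n => fr ^ (j : ℕ)) hinj
        (fun j => (c j • fun x : U => (fr ^ (j : ℕ)) ((σ ^ i) (x : F)))) ?_ j
      intro a
      obtain ⟨g, ⟨b, rfl⟩, hg⟩ := hφ (Polynomial.C a * Polynomial.X ^ Fintype.card K ^ (s * i))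
        ⟨Pi.single ⟨i, hi⟩ a, by
          rw [Finset.sum_eq_single ⟨i, hi⟩]
          · simp
          · intro l _ hl; simp [Pi.single_eq_of_ne hl]
          · simp⟩
      refine (Submodule.mem_span_range_iff_exists_fun F).2 ⟨b, ?_⟩
      funext x
      have h1 := hg x x.2
      rw [Polynomial.eval_finset_sum, hc'] at h1
      simp only [Polynomial.eval_mul, Polynomial.eval_C, Polynomial.eval_pow,
        Polynomial.eval_X, map_mul, ← hσp] at h1
      simp only [Finset.sum_apply, Pi.smul_apply, smul_eq_mul]
      rw [← h1]
      exact Finset.sum_congr rfl fun l _ => by ring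
    have hdvd : ∀ j : Fin n, c j ≠ 0 → t ∣ (j : ℕ) := by
      intro j hj
      have hfix := aux_fix σ (fr ^ (j : ℕ)) hσ (by
          intro i x
          rw [hfrp, hσp, hfrp, hσp, ← pow_mul, ← pow_mul, mul_comm])
        U hone k hk (hU ▸ hkm) (by
          intro i hi
          have h1 := V.smul_mem (c j)⁻¹ (hV i hi j)
          rw [smul_smul, inv_mul_cancel₀ hj, one_smul] at h1
          obtain ⟨b, hb⟩ := (Submodule.mem_span_range_iff_exists_fun F).1 h1
          refine ⟨fun l => if h : l < k then b ⟨l, h⟩ else 0, fun x hx => ?_⟩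
          have h2 := congrFun hb ⟨x, hx⟩
          simp only [Finset.sum_apply, Pi.smul_apply, smul_eq_mul] at h2
          rw [← h2, Finset.sum_range]
          simp)
      let Fx : IntermediateField K F :=
        (AlgHom.equalizer (fr ^ (j : ℕ)) (AlgHom.id K F)).toIntermediateField (by
          intro x hx
          simp only [AlgHom.mem_equalizer, AlgHom.id_apply] at hx ⊢
          rw [map_inv₀, hx])
      have hFx : ∀ x, x ∈ Fx ↔ (fr ^ (j : ℕ)) x = x := fun x => Iff.rfl
      have hle := htmin (E ⊓ Fx) (fun x hx => ⟨hUE hx, (hFx x).2 (hfix x hx)⟩)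
      have heq := IntermediateField.eq_of_le_of_finrank_le
        (inf_le_left : E ⊓ Fx ≤ E) (by rw [hEt]; exact hle)
      have hEF : E ≤ Fx := inf_eq_left.1 heq
      rw [← hEt, ← FiniteField.orderOf_frobeniusAlgHom K E]
      apply orderOf_dvd_of_pow_eq_one
      ext x
      have h1 := (hFx x).1 (hEF x.2)
      rw [hfrp] at h1
      rw [aux_frob_pow]
      simpa using h1
    have hlt : ∀ i : Fin r, t * (i : ℕ) < n := by
      intro i; rw [hnr]; exact Nat.mul_lt_mul_of_pos_left i.2 htpos
    refine ⟨fun i => c ⟨t * i, hlt i⟩, fun x => ?_⟩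
    rw [hc']
    symm
    refine Finset.sum_of_injOn (fun i : Fin r => (⟨t * i, hlt i⟩ : Fin n)) ?_ ?_ ?_ ?_
    · intro i _ i' _ h
      simp only [Fin.mk.injEq] at h
      exact Fin.ext (Nat.eq_of_mul_eq_mul_left htpos h)
    · intro i _; simp
    · intro j _ hj
      by_cases h : c j = 0
      · rw [h, zero_mul]
      · exfalso
        obtain ⟨i, hi⟩ := hdvd j h
        apply hj
        have hir : i < r := by
          have := j.2
          rw [hi, hnr] at this
          exact Nat.lt_of_mul_lt_mul_left this
        exact ⟨⟨i, hir⟩, by simp, Fin.ext hi.symm⟩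
    · intro i _; rw [hfrp]
  · rintro ⟨c, hc⟩ f ⟨a, rfl⟩
    refine ⟨_, ⟨fun l => ∑ i : Fin r, c i * a l ^ Fintype.card K ^ (t * (i : ℕ)), rfl⟩, ?_⟩
    intro x hx
    rw [hc]
    simp only [Polynomial.eval_finset_sum, Polynomial.eval_mul, Polynomial.eval_C,
      Polynomial.eval_pow, Polynomial.eval_X, Finset.sum_mul]
    rw [Finset.sum_comm]
    refine Finset.sum_congr rfl fun i _ => ?_
    rw [← hfrp, map_sum, Finset.mul_sum]
    refine Finset.sum_congr rfl fun l _ => ?_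
    rw [map_mul, map_pow, hfrp, hfrp, hEfix x (hUE hx), mul_assoc]
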